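/- Assume (A.1), let α ∈ (0,1), and let v_α : S × Γ → ℝ be a bounded function solving the discounted Bellman equation v_α(π, δ) = δ · sup_{π' ∈ S} μ^δ( ln⟨π', w⟩ + ln s(π, π') + δ^{-1} v_α(G(π', w), δ e^{-α}) ). Then for all π, π̄ ∈ S and δ ∈ Γ: inf_{π' ∈ S} δ ln( s(π, π') / s(π̄, π') ) ≤ v_α(π, δ) − v_α(π̄, δ) ≤ sup_{π' ∈ S} δ ln( s(π, π') / s(π̄, π') ). -/

import Mathlib

open MeasureTheory Set

noncomputable section

/-- Standard scalar product on `ℝ^d`. -/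
def ip {d : ℕ} (x y : Fin d → ℝ) : ℝ := ∑ i, x i * y i

/-- `G(x,y) = (x·y)/⟨x,y⟩` (componentwise product, normalised). -/
def Gmap {d : ℕ} (x y : Fin d → ℝ) : Fin d → ℝ := fun i => x i * y i / ip x y

/-- Entropic utility `μ^γ(X) = (1/γ) ln E[e^{γX}]`. -/
def entropic {Ω : Type*} [MeasurableSpace Ω] (γ : ℝ) (P : Measure Ω) (X : Ω → ℝ) : ℝ :=
  (1 / γ) * Real.log (∫ ω, Real.exp (γ * X ω) ∂P)

/-- The parameter set `Γ = [min(γ,0), max(γ,0)] \ {0}`. -/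
def Gam (γ : ℝ) : Set ℝ := Icc (min γ 0) (max γ 0) \ {0}

/-- The discounted Bellman operator
`(Tv)(π,δ) = δ ⨆_{π' ∈ S} μ^δ(ln⟨π',w⟩ + ln s(π,π') + δ⁻¹ v(G(π',w), δe^{-α}))`. -/
def TOp {d : ℕ} {Ω : Type*} [MeasurableSpace Ω] (P : Measure Ω)
    (s : (Fin d → ℝ) → (Fin d → ℝ) → ℝ) (r : Ω → Fin d → ℝ) (α : ℝ)
    (v : (Fin d → ℝ) → ℝ → ℝ) : (Fin d → ℝ) → ℝ → ℝ :=
  fun π δ => δ * sSup ((fun π' => entropic δ P (fun ω =>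
      Real.log (ip π' (fun i => Real.exp (r ω i))) + Real.log (s π π') +
        δ⁻¹ * v (Gmap π' (fun i => Real.exp (r ω i))) (δ * Real.exp (-α)))) ''
      stdSimplex ℝ (Fin d))

/-- Supremum norm over `S × Γ`. -/
def supNormSG {d : ℕ} (γ : ℝ) (f : (Fin d → ℝ) → ℝ → ℝ) : ℝ :=
  sSup {y | ∃ π ∈ stdSimplex ℝ (Fin d), ∃ δ ∈ Gam γ, y = |f π δ|}

lemma mem_Gam_cases {γ δ : ℝ} (h : δ ∈ Gam γ) : (0 < δ ∧ δ ≤ γ) ∨ (γ ≤ δ ∧ δ < 0) := by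
  obtain ⟨⟨h1, h2⟩, h3⟩ := h
  have h3 : δ ≠ 0 := h3
  rcases lt_or_gt_of_ne h3 with h | h
  · exact .inr ⟨(min_le_iff.1 h1).resolve_right (by linarith), h⟩
  · exact .inl ⟨h, (le_max_iff.1 h2).resolve_right (by linarith)⟩

lemma mul_exp_neg_mem_Gam {γ δ α : ℝ} (h : δ ∈ Gam γ) (hα : 0 < α) :
    δ * Real.exp (-α) ∈ Gam γ := by
  have he := Real.exp_pos (-α)
  have he1 : Real.exp (-α) < 1 := Real.exp_lt_one_iff.2 (by linarith)
  refine ⟨?_, mul_ne_zero h.2 he.ne'⟩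
  rcases mem_Gam_cases h with ⟨h1, h2⟩ | ⟨h1, h2⟩
  · exact ⟨min_le_of_right_le (by positivity), le_max_of_le_left (by nlinarith)⟩
  · exact ⟨min_le_of_left_le (by nlinarith), le_max_of_le_right (by nlinarith)⟩

lemma exp_mul_le_one_add_exp_mul {γ δ : ℝ} (h : δ ∈ Gam γ) (x : ℝ) :
    Real.exp (δ * x) ≤ 1 + Real.exp (γ * x) := by
  have key : δ * x ≤ 0 ∨ δ * x ≤ γ * x := by
    rcases mem_Gam_cases h with ⟨h1, h2⟩ | ⟨h1, h2⟩ <;> rcases le_total 0 x with hx | hx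
    · right; nlinarith
    · left; nlinarith
    · left; nlinarith
    · right; nlinarith
  rcases key with h | h
  · linarith [Real.exp_le_one_iff.2 h, Real.exp_pos (γ * x)]
  · linarith [Real.exp_le_exp.2 h]

section Simplex

variable {d : ℕ} {x : Fin d → ℝ}

lemma ip_pos_of_mem_stdSimplex (hx : x ∈ stdSimplex ℝ (Fin d)) {y : Fin d → ℝ}
    (hy : ∀ i, 0 < y i) : 0 < ip x y := by
  refine Finset.sum_pos' (fun i _ => mul_nonneg (hx.1 i) (hy i).le) ?_
  by_contra! h
  have h0 : ∑ i, x i ≤ 0 := Finset.sum_nonpos fun i hi => by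
    by_contra! hi0
    linarith [h i hi, mul_pos hi0 (hy i)]
  linarith [hx.2]

lemma Gmap_mem_stdSimplex (hx : x ∈ stdSimplex ℝ (Fin d)) {y : Fin d → ℝ}
    (hy : ∀ i, 0 < y i) : Gmap x y ∈ stdSimplex ℝ (Fin d) := by
  have h := ip_pos_of_mem_stdSimplex hx hy
  refine ⟨fun i => div_nonneg (mul_nonneg (hx.1 i) (hy i).le) h.le, ?_⟩
  simp only [Gmap]
  rw [← Finset.sum_div]
  exact div_self h.ne'

lemma exists_ip_le (hx : x ∈ stdSimplex ℝ (Fin d)) (y : Fin d → ℝ) : ∃ i, ip x y ≤ y i := by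
  by_contra! h
  have h1 : ∑ i, x i * (ip x y - y i) = 0 := by
    simp only [mul_sub, Finset.sum_sub_distrib, ← Finset.sum_mul, hx.2]
    simp [ip]
  have h2 := (Finset.sum_eq_zero_iff_of_nonneg fun i _ =>
    mul_nonneg (hx.1 i) (sub_pos.2 (h i)).le).1 h1
  have h3 : ∑ i, x i = 0 := Finset.sum_eq_zero fun i hi =>
    (mul_eq_zero.1 (h2 i hi)).resolve_right (sub_pos.2 (h i)).ne'
  linarith [hx.2]

lemma exists_le_ip (hx : x ∈ stdSimplex ℝ (Fin d)) (y : Fin d → ℝ) : ∃ i, y i ≤ ip x y := by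
  obtain ⟨i, hi⟩ := exists_ip_le hx (-y)
  refine ⟨i, ?_⟩
  simp only [ip, Pi.neg_apply, mul_neg, Finset.sum_neg_distrib] at hi ⊢
  linarith

lemma exists_log_ip_le (hx : x ∈ stdSimplex ℝ (Fin d)) (y : Fin d → ℝ) :
    ∃ i, Real.log (ip x fun i => Real.exp (y i)) ≤ y i := by
  obtain ⟨i, hi⟩ := exists_ip_le hx fun i => Real.exp (y i)
  exact ⟨i, (Real.log_le_iff_le_exp
    (ip_pos_of_mem_stdSimplex hx fun i => Real.exp_pos _)).2 hi⟩

lemma exists_le_log_ip (hx : x ∈ stdSimplex ℝ (Fin d)) (y : Fin d → ℝ) :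
    ∃ i, y i ≤ Real.log (ip x fun i => Real.exp (y i)) := by
  obtain ⟨i, hi⟩ := exists_le_ip hx fun i => Real.exp (y i)
  exact ⟨i, (Real.le_log_iff_exp_le
    (ip_pos_of_mem_stdSimplex hx fun i => Real.exp_pos _)).2 hi⟩

lemma exists_mul_log_ip_le (hx : x ∈ stdSimplex ℝ (Fin d)) (γ : ℝ) (y : Fin d → ℝ) :
    ∃ i, γ * Real.log (ip x fun i => Real.exp (y i)) ≤ γ * y i := by
  rcases le_total 0 γ with h | h
  · obtain ⟨i, hi⟩ := exists_log_ip_le hx y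
    exact ⟨i, mul_le_mul_of_nonneg_left hi h⟩
  · obtain ⟨i, hi⟩ := exists_le_log_ip hx y
    exact ⟨i, mul_le_mul_of_nonpos_left hi h⟩

end Simplex

section Entropic

variable {Ω : Type*} [MeasurableSpace Ω] {P : Measure Ω} {δ : ℝ} {X Y : Ω → ℝ}

lemma integral_exp_mul_add_const (c : ℝ) :
    ∫ ω, Real.exp (δ * (X ω + c)) ∂P = (∫ ω, Real.exp (δ * X ω) ∂P) * Real.exp (δ * c) := by
  simp only [mul_add, Real.exp_add, integral_mul_const]

lemma entropic_add_const (hδ : δ ≠ 0) (h : ∫ ω, Real.exp (δ * X ω) ∂P ≠ 0) (c : ℝ) :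
    entropic δ P (fun ω => X ω + c) = entropic δ P X + c := by
  rw [entropic, integral_exp_mul_add_const, Real.log_mul h (Real.exp_ne_zero _), Real.log_exp,
    entropic]
  field_simp

lemma entropic_add_const_of_integral_eq_zero (h : ∫ ω, Real.exp (δ * X ω) ∂P = 0) (c : ℝ) :
    entropic δ P (fun ω => X ω + c) = 0 := by
  rw [entropic, integral_exp_mul_add_const, h]
  simp

lemma entropic_mono [NeZero P] (hX : Integrable (fun ω => Real.exp (δ * X ω)) P)
    (hY : Integrable (fun ω => Real.exp (δ * Y ω)) P) (h : ∀ ω, X ω ≤ Y ω) :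
    entropic δ P X ≤ entropic δ P Y := by
  have hX0 := integral_exp_pos hX
  have hY0 := integral_exp_pos hY
  rcases le_total 0 δ with hδ | hδ
  · refine mul_le_mul_of_nonneg_left (Real.log_le_log hX0 (integral_mono hX hY fun ω => ?_))
      (one_div_nonneg.2 hδ)
    exact Real.exp_le_exp.2 (mul_le_mul_of_nonneg_left (h ω) hδ)
  · refine mul_le_mul_of_nonpos_left (Real.log_le_log hY0 (integral_mono hY hX fun ω => ?_))
      (one_div_nonpos.2 hδ)
    exact Real.exp_le_exp.2 (mul_le_mul_of_nonpos_left (h ω) hδ)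

lemma entropic_le_max [NeZero P] (hY : Integrable (fun ω => Real.exp (δ * Y ω)) P)
    (h : ∀ ω, X ω ≤ Y ω) : entropic δ P X ≤ max (entropic δ P Y) 0 := by
  by_cases hX : Integrable (fun ω => Real.exp (δ * X ω)) P
  · exact le_max_of_le_left (entropic_mono hX hY h)
  · refine le_max_of_le_right ?_
    rw [entropic, integral_undef hX]
    simp

lemma integrable_exp_mul_of_exists_le [IsFiniteMeasure P] {ι : Type*} [Fintype ι] {γ : ℝ}
    (hδ : δ ∈ Gam γ) {r : Ω → ι → ℝ} (hr : ∀ i, Integrable (fun ω => Real.exp (γ * r ω i)) P)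
    (hX : Measurable X) (h : ∀ ω, ∃ i, γ * X ω ≤ γ * r ω i) :
    Integrable (fun ω => Real.exp (δ * X ω)) P := by
  refine Integrable.mono' ((integrable_const (1 : ℝ)).add
    (integrable_finsetSum Finset.univ fun i _ => hr i)) (by fun_prop) (.of_forall fun ω => ?_)
  obtain ⟨i, hi⟩ := h ω
  rw [Real.norm_of_nonneg (Real.exp_pos _).le]
  refine (exp_mul_le_one_add_exp_mul hδ _).trans ?_
  simp only [Pi.add_apply]
  gcongr
  exact (Real.exp_le_exp.2 hi).trans (Finset.single_le_sum
    (f := fun i => Real.exp (γ * r ω i)) (fun i _ => (Real.exp_pos _).le) (Finset.mem_univ i))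

lemma integrable_exp_mul_add_of_bounded {C : ℝ}
    (hX : Integrable (fun ω => Real.exp (δ * X ω)) P)
    (hY : Measurable Y) (hb : ∀ ω, |Y ω| ≤ C) :
    Integrable (fun ω => Real.exp (δ * (X ω + Y ω))) P := by
  simp only [mul_add, Real.exp_add]
  refine hX.mul_bdd (c := Real.exp (|δ| * C)) (by fun_prop) (.of_forall fun ω => ?_)
  rw [Real.norm_of_nonneg (Real.exp_pos _).le]
  refine Real.exp_le_exp.2 ((le_abs_self _).trans ?_)
  rw [abs_mul]
  exact mul_le_mul_of_nonneg_left (hb ω) (abs_nonneg δ)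

end Entropic

lemma mul_sSup_image_sub_le {ι : Type*} {S : Set ι} (hS : S.Nonempty) {f g : ι → ℝ} {δ B : ℝ}
    (hδ : δ ≠ 0) (hf : BddAbove (f '' S)) (hg : BddAbove (g '' S))
    (h : ∀ i ∈ S, δ * (f i - g i) ≤ B) : δ * sSup (f '' S) - δ * sSup (g '' S) ≤ B := by
  rcases lt_or_gt_of_ne hδ with hn | hp
  · have : sSup (g '' S) ≤ sSup (f '' S) + B / (-δ) := by
      refine csSup_le (hS.image g) ?_
      rintro _ ⟨i, hi, rfl⟩
      have h1 := le_csSup hf (mem_image_of_mem f hi)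
      have h2 : g i - f i ≤ B / (-δ) := by
        rw [le_div_iff₀ (by linarith)]
        linarith [h i hi]
      linarith
    have h3 : sSup (g '' S) - sSup (f '' S) ≤ B / (-δ) := by linarith
    rw [le_div_iff₀ (by linarith)] at h3
    linarith
  · have : sSup (f '' S) ≤ sSup (g '' S) + B / δ := by
      refine csSup_le (hS.image f) ?_
      rintro _ ⟨i, hi, rfl⟩
      have h1 := le_csSup hg (mem_image_of_mem g hi)
      have h2 : f i - g i ≤ B / δ := by
        rw [le_div_iff₀ hp]
        linarith [h i hi]
      linarith
    have h3 : sSup (f '' S) - sSup (g '' S) ≤ B / δ := by linarith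
    rw [le_div_iff₀ hp] at h3
    linarith

/-- Lemma `lem:v.alpha.span`: under (A.1), if `α ∈ (0,1)` and `v_α` is a
bounded solution of the discounted Bellman equation, then for all `π, π̄ ∈ S`, `δ ∈ Γ`:
`inf_{π'} δ ln(s(π,π')/s(π̄,π')) ≤ v_α(π,δ) − v_α(π̄,δ) ≤ sup_{π'} δ ln(s(π,π')/s(π̄,π'))`. -/
theorem discounted_bellman_span_bounds {d : ℕ} (hd : 0 < d) {Ω : Type*} [MeasurableSpace Ω]
    (P : Measure Ω) [IsProbabilityMeasure P]
    (st : ℝ) (hst : st ∈ Ioo (0 : ℝ) 1)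
    (s : (Fin d → ℝ) → (Fin d → ℝ) → ℝ)
    (hs : ∀ x ∈ stdSimplex ℝ (Fin d), ∀ y ∈ stdSimplex ℝ (Fin d), s x y ∈ Icc st 1)
    (hscont : ContinuousOn (fun p : (Fin d → ℝ) × (Fin d → ℝ) => s p.1 p.2)
      (stdSimplex ℝ (Fin d) ×ˢ stdSimplex ℝ (Fin d)))
    (γ : ℝ) (hγ : γ ≠ 0) (r : Ω → Fin d → ℝ) (hrm : Measurable r)
    (hA1exp : ∀ i, Integrable (fun ω => Real.exp (γ * r ω i)) P)
    (hA1int : ∀ i, Integrable (fun ω => r ω i) P)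
    (α : ℝ) (hα : α ∈ Ioo (0 : ℝ) 1)
    (v : (Fin d → ℝ) → ℝ → ℝ)
    (hvb : ∃ C : ℝ, ∀ π ∈ stdSimplex ℝ (Fin d), ∀ δ ∈ Gam γ, |v π δ| ≤ C)
    (hvbell : ∀ π ∈ stdSimplex ℝ (Fin d), ∀ δ ∈ Gam γ, v π δ = TOp P s r α v π δ) :
    ∀ π ∈ stdSimplex ℝ (Fin d), ∀ π_bar ∈ stdSimplex ℝ (Fin d), ∀ δ ∈ Gam γ,
      sInf ((fun π' => δ * Real.log (s π π' / s π_bar π')) '' stdSimplex ℝ (Fin d)) ≤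
          v π δ - v π_bar δ ∧
        v π δ - v π_bar δ ≤
          sSup ((fun π' => δ * Real.log (s π π' / s π_bar π')) '' stdSimplex ℝ (Fin d)) := by
  obtain ⟨C, hC⟩ := hvb
  have : Nonempty (Fin d) := ⟨⟨0, hd⟩⟩
  have hspos : ∀ x ∈ stdSimplex ℝ (Fin d), ∀ y ∈ stdSimplex ℝ (Fin d), 0 < s x y :=
    fun x hx y hy => hst.1.trans_le (hs x hx y hy).1
  let w : Ω → Fin d → ℝ := fun ω i => Real.exp (r ω i)
  have hw : ∀ ω i, 0 < w ω i := fun ω i => Real.exp_pos _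
  have hri : ∀ i, Measurable fun ω => r ω i := fun i => (measurable_pi_apply i).comp hrm
  have hwi : ∀ i, Measurable fun ω => w ω i := fun i => (hri i).exp
  have hipm : ∀ p : Fin d → ℝ, Measurable fun ω => ip p (w ω) := fun p =>
    Finset.measurable_sum _ fun i _ => (hwi i).const_mul _
  have hGm : ∀ p : Fin d → ℝ, Measurable fun ω => Gmap p (w ω) := fun p =>
    measurable_pi_lambda _ fun i => ((hwi i).const_mul _).div (hipm p)
  have hGmem : ∀ p ∈ stdSimplex ℝ (Fin d), ∀ ω, Gmap p (w ω) ∈ stdSimplex ℝ (Fin d) :=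
    fun p hp ω => Gmap_mem_stdSimplex hp (hw ω)
  have hvG : ∀ δ ∈ Gam γ, ∀ p ∈ stdSimplex ℝ (Fin d), ∀ ω,
      |δ⁻¹ * v (Gmap p (w ω)) (δ * Real.exp (-α))| ≤ |δ⁻¹| * C := fun δ hδ p hp ω => by
    rw [abs_mul]
    exact mul_le_mul_of_nonneg_left (hC _ (hGmem p hp ω) _ (mul_exp_neg_mem_Gam hδ hα.1))
      (abs_nonneg _)
  let X : ℝ → (Fin d → ℝ) → Ω → ℝ := fun δ p ω =>
    Real.log (ip p (w ω)) + δ⁻¹ * v (Gmap p (w ω)) (δ * Real.exp (-α))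
  let F : ℝ → (Fin d → ℝ) → (Fin d → ℝ) → ℝ := fun δ x p =>
    entropic δ P fun ω => X δ p ω + Real.log (s x p)
  have hvF : ∀ δ ∈ Gam γ, ∀ x ∈ stdSimplex ℝ (Fin d),
      v x δ = δ * sSup (F δ x '' stdSimplex ℝ (Fin d)) := fun δ hδ x hx => by
    rw [hvbell x hx δ hδ]
    simp only [TOp, F, X, w, add_right_comm]
  have hbdd : ∀ δ ∈ Gam γ, ∃ M, ∀ x ∈ stdSimplex ℝ (Fin d), ∀ p ∈ stdSimplex ℝ (Fin d),
      F δ x p ≤ M := fun δ hδ => by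
    let R : Ω → ℝ := Finset.univ.sup' Finset.univ_nonempty fun i ω => r ω i
    have hRm : Measurable R := Finset.measurable_sup' _ fun i _ => hri i
    have hRle : ∀ ω i, r ω i ≤ R ω := fun ω i =>
      Finset.le_sup' (fun i ω => r ω i) (Finset.mem_univ i) ω
    have hRex : ∀ ω, ∃ i, γ * R ω ≤ γ * r ω i := fun ω => by
      obtain ⟨i, -, hi⟩ := Finset.exists_mem_eq_sup' Finset.univ_nonempty fun i => r ω i
      exact ⟨i, by simp only [R, Finset.sup'_apply, hi, le_refl]⟩
    have hR := integrable_exp_mul_add_of_bounded (Y := fun _ => |δ⁻¹| * C)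
      (integrable_exp_mul_of_exists_le hδ hA1exp hRm hRex) measurable_const fun _ => le_rfl
    refine ⟨_, fun x hx p hp => entropic_le_max hR fun ω => ?_⟩
    obtain ⟨i, hi⟩ := exists_log_ip_le hp (r ω)
    have h1 := (le_abs_self _).trans (hvG δ hδ p hp ω)
    have h2 := Real.log_nonpos (hspos x hx p hp).le (hs x hx p hp).2
    have h3 := le_abs_self (|δ⁻¹| * C)
    have h4 := hRle ω i
    change Real.log (ip p (w ω)) ≤ _ at hi
    simp only [X]
    linarith
  have hbddF : ∀ δ ∈ Gam γ, ∀ x ∈ stdSimplex ℝ (Fin d),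
      BddAbove (F δ x '' stdSimplex ℝ (Fin d)) := fun δ hδ x hx => by
    obtain ⟨M, hM⟩ := hbdd δ hδ
    exact ⟨M, forall_mem_image.2 fun p hp => hM x hx p hp⟩
  -- No measurability of `v` is assumed: the Bellman equation forces it.
  have hvm : ∀ δ ∈ Gam γ, Measurable fun x : stdSimplex ℝ (Fin d) => v x.1 δ := fun δ hδ => by
    have hcont : ∀ p : stdSimplex ℝ (Fin d),
        Continuous fun x : stdSimplex ℝ (Fin d) => F δ x.1 p.1 := fun p => by
      by_cases h : ∫ ω, Real.exp (δ * X δ p.1 ω) ∂P = 0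
      · simp only [F, entropic_add_const_of_integral_eq_zero h]
        exact continuous_const
      · simp only [F, entropic_add_const hδ.2 h]
        refine continuous_const.add (Continuous.log ?_ fun x => (hspos x.1 x.2 p.1 p.2).ne')
        exact hscont.comp_continuous (f := fun x : stdSimplex ℝ (Fin d) => (x.1, p.1))
          (by fun_prop) fun x => ⟨x.2, p.2⟩
    have hlsc : LowerSemicontinuous fun x : stdSimplex ℝ (Fin d) =>
        ⨆ p : stdSimplex ℝ (Fin d), F δ x.1 p.1 :=
      lowerSemicontinuous_ciSup
        (fun x => by
          have h := hbddF δ hδ x.1 x.2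
          rw [image_eq_range] at h
          exact h)
        fun p => (hcont p).lowerSemicontinuous
    have heq : (fun x : stdSimplex ℝ (Fin d) => v x.1 δ) =
        fun x : stdSimplex ℝ (Fin d) => δ * ⨆ p : stdSimplex ℝ (Fin d), F δ x.1 p.1 := by
      funext x
      rw [hvF δ hδ x.1 x.2, sSup_image']
    rw [heq]
    exact hlsc.measurable.const_mul δ
  have hXint : ∀ δ ∈ Gam γ, ∀ p ∈ stdSimplex ℝ (Fin d),
      Integrable (fun ω => Real.exp (δ * X δ p ω)) P := fun δ hδ p hp =>
    integrable_exp_mul_add_of_bounded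
      (integrable_exp_mul_of_exists_le hδ hA1exp (hipm p).log
        fun ω => exists_mul_log_ip_le hp γ (r ω))
      (((hvm _ (mul_exp_neg_mem_Gam hδ hα.1)).comp
        ((hGm p).subtype_mk (h := hGmem p hp))).const_mul _)
      (hvG δ hδ p hp)
  have hFsub : ∀ δ ∈ Gam γ, ∀ x ∈ stdSimplex ℝ (Fin d), ∀ y ∈ stdSimplex ℝ (Fin d),
      ∀ p ∈ stdSimplex ℝ (Fin d), F δ x p - F δ y p = Real.log (s x p / s y p) :=
    fun δ hδ x hx y hy p hp => by
      have h := (integral_exp_pos (hXint δ hδ p hp)).ne'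
      simp only [F, entropic_add_const hδ.2 h,
        Real.log_div (hspos x hx p hp).ne' (hspos y hy p hp).ne']
      ring
  have hupper : ∀ x ∈ stdSimplex ℝ (Fin d), ∀ y ∈ stdSimplex ℝ (Fin d), ∀ δ ∈ Gam γ,
      v x δ - v y δ ≤
        sSup ((fun p => δ * Real.log (s x p / s y p)) '' stdSimplex ℝ (Fin d)) := by
    intro x hx y hy δ hδ
    rw [hvF δ hδ x hx, hvF δ hδ y hy]
    refine mul_sSup_image_sub_le ⟨x, hx⟩ hδ.2 (hbddF δ hδ x hx) (hbddF δ hδ y hy)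
      fun p hp => ?_
    rw [hFsub δ hδ x hx y hy p hp]
    refine le_csSup ⟨|δ| * -Real.log st, forall_mem_image.2 fun q hq => ?_⟩
      (mem_image_of_mem (fun p => δ * Real.log (s x p / s y p)) hp)
    refine (le_abs_self _).trans ?_
    rw [abs_mul, Real.log_div (hspos x hx q hq).ne' (hspos y hy q hq).ne']
    refine mul_le_mul_of_nonneg_left (abs_le.2 ?_) (abs_nonneg δ)
    have h1 := Real.log_le_log hst.1 (hs x hx q hq).1
    have h2 := Real.log_le_log hst.1 (hs y hy q hq).1
    have h3 := Real.log_nonpos (hspos x hx q hq).le (hs x hx q hq).2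
    have h4 := Real.log_nonpos (hspos y hy q hq).le (hs y hy q hq).2
    constructor <;> linarith
  intro x hx y hy δ hδ
  refine ⟨?_, hupper x hx y hy δ hδ⟩
  have h := hupper y hy x hx δ hδ
  have hneg : (fun p => δ * Real.log (s y p / s x p)) '' stdSimplex ℝ (Fin d) =
      -((fun p => δ * Real.log (s x p / s y p)) '' stdSimplex ℝ (Fin d)) := by
    rw [← Set.image_neg_eq_neg, Set.image_image]
    refine image_congr fun p _ => ?_
    rw [← inv_div, Real.log_inv]
    ring
  rw [hneg] at h
  rw [Real.sInf_def]
  linarith
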